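/- arXiv:2206.01026 — 2 statements merged into one kernel-verified Lean document; each statement's English description precedes it below -/
import Mathlib

section
/- Define F(p,s) = ∫_0^∞ |𝔧₁(t)|^s t^{p-1} dt and U(p,s) = 4^p (2π·15^{1/2})^{-s/2} / (3s/2 - p) + 2^{3p/2-1} s^{-p/2} ( Γ(p/2) - Γ(p/2+2)/(6s) + Γ(p/2+4)/(72 s²) ). Then for all p, s > 0 with p < 3s/2, one has F(p,s) < U(p,s). -/
open MeasureTheory Real Set
open scoped ENNReal

/-- `𝔧₁(t) = ∑_{k=0}^∞ (-1)^k / (k! (k+1)!) (t/2)^{2k} = 2J₁(t)/t`. -/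
noncomputable def jj1 (t : ℝ) : ℝ :=
  ∑' k : ℕ, ((-1 : ℝ) ^ k / ((k.factorial : ℝ) * ((k + 1).factorial : ℝ))) * (t / 2) ^ (2 * k)

/-- The upper bound `U(p,s)` for `F(p,s) = ∫_0^∞ |𝔧₁(t)|^s t^{p-1} dt`. -/
noncomputable def Ufun (p s : ℝ) : ℝ :=
  4 ^ p * (2 * Real.pi * Real.sqrt 15) ^ (-s / 2) / (3 * s / 2 - p) +
    2 ^ (3 * p / 2 - 1) * s ^ (-p / 2) *
      (Real.Gamma (p / 2) - Real.Gamma (p / 2 + 2) / (6 * s) +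
        Real.Gamma (p / 2 + 4) / (72 * s ^ 2))

/-- The entire function `∑ (-y)^k / (k! (k+m)!)`, so that `J_m(t) = (t/2)^m besselAux m (t²/4)`. -/
noncomputable def besselAux (m : ℕ) (y : ℝ) : ℝ :=
  ∑' k : ℕ, (-1 : ℝ) ^ k * (y ^ k / ((k.factorial : ℝ) * ((k + m).factorial : ℝ)))

theorem jj1_eq_besselAux (t : ℝ) : jj1 t = besselAux 1 (t ^ 2 / 4) := by
  unfold jj1 besselAux
  refine tsum_congr fun k => ?_
  rw [pow_mul, show (t / 2) ^ 2 = t ^ 2 / 4 by ring]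
  ring

theorem summable_besselAux_term (m : ℕ) (y : ℝ) :
    Summable fun k : ℕ => y ^ k / ((k.factorial : ℝ) * ((k + m).factorial : ℝ)) := by
  refine Summable.of_norm_bounded (Real.summable_pow_div_factorial |y|) fun k => ?_
  rw [norm_div, norm_pow, Real.norm_eq_abs, Real.norm_of_nonneg (by positivity)]
  gcongr
  exact le_mul_of_one_le_right (by positivity) (by exact_mod_cast Nat.factorial_pos _)

theorem summable_besselAux (m : ℕ) (y : ℝ) :
    Summable fun k : ℕ =>
      (-1 : ℝ) ^ k * (y ^ k / ((k.factorial : ℝ) * ((k + m).factorial : ℝ))) :=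
  (summable_besselAux_term m y).alternating

theorem hasDerivAt_besselAux (m : ℕ) (y : ℝ) :
    HasDerivAt (besselAux m) (-besselAux (m + 1) y) y := by
  set R : ℝ := |y| + 1 with hR
  have hR0 : 0 ≤ R := by positivity
  have hderiv := hasDerivAt_tsum_of_isPreconnected (t := Metric.ball (0 : ℝ) R) (y₀ := y) (y := y)
    (g := fun (k : ℕ) z =>
      (-1 : ℝ) ^ k * (z ^ k / ((k.factorial : ℝ) * ((k + m).factorial : ℝ))))
    (g' := fun (k : ℕ) z =>
      (-1 : ℝ) ^ k * (k * z ^ (k - 1) / ((k.factorial : ℝ) * ((k + m).factorial : ℝ))))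
    (u := fun k : ℕ => R ^ (k - 1) / ((k - 1).factorial : ℝ))
    ((summable_nat_add_iff 1).mp (by simpa using Real.summable_pow_div_factorial R))
    Metric.isOpen_ball (convex_ball (0 : ℝ) R).isPreconnected
    (fun k z _ => ((hasDerivAt_pow k z).div_const _).const_mul _)
    (fun k z hz => ?_) (by simp [hR]) (summable_besselAux m y) (by simp [hR])
  · refine hderiv.congr_deriv ?_
    rw [Summable.tsum_eq_zero_add]
    · simp only [besselAux, ← tsum_neg, Nat.cast_zero, zero_mul, zero_div, mul_zero, zero_add]
      refine tsum_congr fun k => ?_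
      rw [show k + 1 + m = k + (m + 1) by ring, Nat.factorial_succ k]
      push_cast
      have : (k : ℝ) + 1 ≠ 0 := by positivity
      field_simp
      ring
    · refine (summable_nat_add_iff 1).mp ((summable_besselAux (m + 1) y).neg.congr fun k => ?_)
      rw [show k + 1 + m = k + (m + 1) by ring, Nat.factorial_succ k]
      push_cast
      have : (k : ℝ) + 1 ≠ 0 := by positivity
      field_simp
      ring
  · have hz' : |z| ≤ R := by simpa using (mem_ball_zero_iff.mp hz).le
    rw [norm_mul, norm_pow, norm_neg, norm_one, one_pow, one_mul, norm_div, norm_mul, norm_pow,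
      Real.norm_of_nonneg (by positivity : (0 : ℝ) ≤ k.factorial * (k + m).factorial),
      Real.norm_of_nonneg (Nat.cast_nonneg k), Real.norm_eq_abs]
    rcases k with _ | k
    · simp
    · rw [Nat.factorial_succ k]
      push_cast
      have h1 : (1 : ℝ) ≤ ((k + 1 + m).factorial : ℝ) := by exact_mod_cast Nat.factorial_pos _
      calc ((k : ℝ) + 1) * |z| ^ k / ((k + 1) * k.factorial * (k + 1 + m).factorial)
          = |z| ^ k / (k.factorial * (k + 1 + m).factorial) := by
            have : (k : ℝ) + 1 ≠ 0 := by positivity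
            field_simp
        _ ≤ R ^ k / k.factorial := by
            gcongr
            exact le_mul_of_one_le_right (by positivity) h1

theorem besselAux_recurrence (m : ℕ) (y : ℝ) :
    besselAux m y = (m + 1) * besselAux (m + 1) y - y * besselAux (m + 2) y := by
  have hsub : besselAux m y - (m + 1) * besselAux (m + 1) y = -y * besselAux (m + 2) y := by
    unfold besselAux
    rw [← tsum_mul_left, ← tsum_mul_left, ← Summable.tsum_sub (summable_besselAux m y)
      ((summable_besselAux (m + 1) y).mul_left _), Summable.tsum_eq_zero_add
      ((summable_besselAux m y).sub ((summable_besselAux (m + 1) y).mul_left _))]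
    have h0 : (-1 : ℝ) ^ 0 * (y ^ 0 / ((Nat.factorial 0 : ℝ) * ((0 + m).factorial : ℝ))) -
        (m + 1) * ((-1 : ℝ) ^ 0 * (y ^ 0 / ((Nat.factorial 0 : ℝ) * ((0 + (m + 1)).factorial : ℝ))))
        = 0 := by
      simp only [zero_add, Nat.factorial_succ m]
      push_cast
      have : (m : ℝ) + 1 ≠ 0 := by positivity
      simp
      field_simp
      ring
    rw [h0, zero_add]
    refine tsum_congr fun k => ?_
    rw [show k + 1 + (m + 1) = (k + 1 + m) + 1 by ring, show k + (m + 2) = (k + 1 + m) + 1 by ring,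
      Nat.factorial_succ (k + 1 + m), Nat.factorial_succ k]
    push_cast
    have h1 : (k : ℝ) + 1 ≠ 0 := by positivity
    have h2 : (k : ℝ) + 1 + m + 1 ≠ 0 := by positivity
    field_simp
    ring
  linarith

theorem antitone_besselAux_term {m : ℕ} {y : ℝ} (hy0 : 0 ≤ y) (hy : y ≤ 4) :
    Antitone fun k : ℕ =>
      y ^ (k + 1) / (((k + 1).factorial : ℝ) * ((k + 1 + m).factorial : ℝ)) := by
  refine antitone_nat_of_succ_le fun k => ?_
  rw [show k + 1 + 1 + m = (k + 1 + m) + 1 by ring, Nat.factorial_succ (k + 1 + m),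
    Nat.factorial_succ (k + 1), div_le_div_iff₀ (by positivity) (by positivity)]
  push_cast
  have h : y ≤ ((k : ℝ) + 1 + 1) * (k + 1 + m + 1) := by
    have h1 : (0 : ℝ) ≤ k := Nat.cast_nonneg k
    have h2 : (0 : ℝ) ≤ m := Nat.cast_nonneg m
    nlinarith [mul_nonneg h1 h1, mul_nonneg h1 h2]
  calc y ^ (k + 1 + 1) * ((k + 1).factorial * (k + 1 + m).factorial)
      = y * (y ^ (k + 1) * ((k + 1).factorial * (k + 1 + m).factorial)) := by ring
    _ ≤ ((k : ℝ) + 1 + 1) * (k + 1 + m + 1) *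
          (y ^ (k + 1) * ((k + 1).factorial * (k + 1 + m).factorial)) := by gcongr
    _ = _ := by ring

theorem besselAux_eq_sub_alternating (m : ℕ) (y : ℝ) :
    besselAux m y = 1 / (m.factorial : ℝ) - ∑' k : ℕ, (-1 : ℝ) ^ k *
      (y ^ (k + 1) / (((k + 1).factorial : ℝ) * ((k + 1 + m).factorial : ℝ))) := by
  unfold besselAux
  rw [Summable.tsum_eq_zero_add (summable_besselAux m y), sub_eq_add_neg, ← tsum_neg]
  congr 1
  · simp
  · refine tsum_congr fun k => ?_
    ring

theorem besselAux_le_partial_sum {m : ℕ} {y : ℝ} (hy0 : 0 ≤ y) (hy : y ≤ 4) (n : ℕ) :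
    besselAux m y ≤ 1 / (m.factorial : ℝ) - ∑ k ∈ Finset.range (2 * n), (-1 : ℝ) ^ k *
      (y ^ (k + 1) / (((k + 1).factorial : ℝ) * ((k + 1 + m).factorial : ℝ))) := by
  rw [besselAux_eq_sub_alternating]
  exact sub_le_sub_left ((antitone_besselAux_term hy0 hy).alternating_series_le_tendsto
    ((summable_nat_add_iff 1).mpr (summable_besselAux_term m y)).tendsto_alternating_series_tsum n) _

theorem partial_sum_le_besselAux {m : ℕ} {y : ℝ} (hy0 : 0 ≤ y) (hy : y ≤ 4) (n : ℕ) :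
    1 / (m.factorial : ℝ) - ∑ k ∈ Finset.range (2 * n + 1), (-1 : ℝ) ^ k *
      (y ^ (k + 1) / (((k + 1).factorial : ℝ) * ((k + 1 + m).factorial : ℝ))) ≤ besselAux m y := by
  rw [besselAux_eq_sub_alternating]
  exact sub_le_sub_left ((antitone_besselAux_term hy0 hy).tendsto_le_alternating_series
    ((summable_nat_add_iff 1).mpr (summable_besselAux_term m y)).tendsto_alternating_series_tsum n) _

theorem besselAux_sub_nonpos {y : ℝ} (hy0 : 0 ≤ y) (hy : y ≤ 4) :
    (1 / 2 + y / 12) * besselAux 1 y - besselAux 2 y ≤ 0 := by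
  have h1 := besselAux_le_partial_sum (m := 1) hy0 hy 2
  have h2 := partial_sum_le_besselAux (m := 2) hy0 hy 2
  norm_num [Finset.sum_range_succ, Nat.factorial] at h1 h2
  have h3 := mul_le_mul_of_nonneg_left h1 (by positivity : 0 ≤ 1 / 2 + y / 12)
  have h4 : -1 / 48 + 7 / 1440 * y - 1 / 2160 * y ^ 2 + (1 / 604800 + 1 / 34560) * y ^ 3 ≤ 0 := by
    nlinarith [mul_nonneg hy0 (sub_nonneg.mpr hy), mul_nonneg (mul_nonneg hy0 hy0)
      (sub_nonneg.mpr hy)]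
  nlinarith [mul_nonneg (sq_nonneg y) (neg_nonneg.mpr h4)]

theorem besselAux_one_zero : besselAux 1 0 = 1 := by
  rw [besselAux_eq_sub_alternating]
  simp

theorem besselAux_one_le_exp {y : ℝ} (hy0 : 0 ≤ y) (hy : y ≤ 4) :
    besselAux 1 y ≤ exp (-(y / 2 + y ^ 2 / 24)) := by
  have hd : ∀ z : ℝ, HasDerivAt (fun z => besselAux 1 z * exp (z / 2 + z ^ 2 / 24))
      (((1 / 2 + z / 12) * besselAux 1 z - besselAux 2 z) * exp (z / 2 + z ^ 2 / 24)) z := by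
    intro z
    have he : HasDerivAt (fun z : ℝ => z / 2 + z ^ 2 / 24) (1 / 2 + z / 12) z := by
      refine (((hasDerivAt_id z).div_const 2).add ((hasDerivAt_pow 2 z).div_const 24)).congr_deriv ?_
      norm_num
      ring
    refine ((hasDerivAt_besselAux 1 z).mul he.exp).congr_deriv ?_
    ring
  have hanti : AntitoneOn (fun z => besselAux 1 z * exp (z / 2 + z ^ 2 / 24)) (Icc 0 4) := by
    refine antitoneOn_of_deriv_nonpos (convex_Icc 0 4)
      (fun z _ => (hd z).continuousAt.continuousWithinAt)
      (fun z _ => (hd z).differentiableAt.differentiableWithinAt) fun z hz => ?_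
    rw [interior_Icc] at hz
    rw [(hd z).deriv]
    exact mul_nonpos_of_nonpos_of_nonneg (besselAux_sub_nonpos hz.1.le hz.2.le) (exp_pos _).le
  have h := hanti (left_mem_Icc.mpr (by norm_num)) ⟨hy0, hy⟩ hy0
  simp only [besselAux_one_zero] at h
  rw [exp_neg, ← one_div, le_div_iff₀ (exp_pos _)]
  simpa using h

theorem neg_exp_le_besselAux_one {y : ℝ} (hy0 : 0 ≤ y) (hy : y ≤ 4) :
    -exp (-(y / 2 + y ^ 2 / 24)) ≤ besselAux 1 y := by
  have h1 : -(1 / 20) ≤ besselAux 1 y := by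
    have h := partial_sum_le_besselAux (m := 1) hy0 hy 2
    norm_num [Finset.sum_range_succ, Nat.factorial] at h
    have hz : 0 ≤ 4 - y := sub_nonneg.mpr hy
    nlinarith [mul_nonneg hz hz, mul_nonneg (mul_nonneg hz hz) hz, pow_nonneg hz 4,
      pow_nonneg hz 5]
  have h2 : 1 / 20 ≤ exp (-(y / 2 + y ^ 2 / 24)) := by
    calc (1 / 20 : ℝ) ≤ exp (-(8 / 3)) := by
          rw [exp_neg, ← one_div]
          apply one_div_le_one_div_of_le (exp_pos _)
          rw [← Real.exp_one_rpow]
          calc exp 1 ^ (8 / 3 : ℝ) ≤ 3 ^ (8 / 3 : ℝ) := by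
                gcongr
                exact Real.exp_one_lt_three.le
            _ ≤ 20 := by
                rw [show (8 / 3 : ℝ) = 8 * (1 / 3) by norm_num, rpow_mul (by norm_num)]
                calc ((3 : ℝ) ^ (8 : ℝ)) ^ (1 / 3 : ℝ) ≤ (20 ^ (3 : ℝ)) ^ (1 / 3 : ℝ) := by
                      gcongr
                      norm_num
                  _ = 20 := by
                      rw [← rpow_mul (by norm_num)]
                      norm_num
      _ ≤ _ := by
          apply exp_le_exp.mpr
          nlinarith
  linarith

theorem abs_jj1_le_exp {t : ℝ} (ht0 : 0 ≤ t) (ht : t ≤ 4) :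
    |jj1 t| ≤ exp (-(t ^ 2 / 8 + t ^ 4 / 384)) := by
  have h0 : 0 ≤ t ^ 2 / 4 := by positivity
  have h4 : t ^ 2 / 4 ≤ 4 := by nlinarith
  rw [jj1_eq_besselAux, show t ^ 2 / 8 + t ^ 4 / 384 = t ^ 2 / 4 / 2 + (t ^ 2 / 4) ^ 2 / 24 by ring,
    abs_le]
  exact ⟨neg_exp_le_besselAux_one h0 h4, besselAux_one_le_exp h0 h4⟩

/-- A Sonin-type energy of the Bessel equation for `J₁`, as a function of `y = t² / 4`. -/
noncomputable def besselEnergy (y : ℝ) : ℝ :=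
  besselAux 1 y ^ 2 + (3 * besselAux 1 y - 4 * y * besselAux 2 y) ^ 2 / (16 * y - 3)

theorem besselEnergy_nonneg {y : ℝ} (hy : 1 ≤ y) : 0 ≤ besselEnergy y := by
  have : 0 < 16 * y - 3 := by linarith
  unfold besselEnergy
  positivity

theorem hasDerivAt_cube_mul_besselEnergy_sq {y : ℝ} (hy : 1 ≤ y) :
    HasDerivAt (fun y => y ^ 3 * besselEnergy y ^ 2) (-(6 * y ^ 2 * besselEnergy y *
      (3 * besselAux 1 y - 4 * y * besselAux 2 y) ^ 2 / (16 * y - 3) ^ 2)) y := by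
  have hq : 16 * y - 3 ≠ 0 := by linarith
  have hlin : HasDerivAt (fun y : ℝ => 16 * y - 3) 16 y := by
    simpa using ((hasDerivAt_id y).const_mul 16).sub_const 3
  have hB : HasDerivAt (fun y : ℝ => 3 * besselAux 1 y - 4 * y * besselAux 2 y)
      (besselAux 2 y - 4 * besselAux 1 y) y := by
    refine (((hasDerivAt_besselAux 1 y).const_mul 3).sub
      (((hasDerivAt_id y).const_mul 4).mul (hasDerivAt_besselAux 2 y))).congr_deriv ?_
    have h := besselAux_recurrence 1 y
    norm_num at h ⊢
    linarith
  have hE : HasDerivAt besselEnergy (2 * besselAux 1 y * -besselAux 2 y +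
      (2 * (3 * besselAux 1 y - 4 * y * besselAux 2 y) * (besselAux 2 y - 4 * besselAux 1 y) *
        (16 * y - 3) - (3 * besselAux 1 y - 4 * y * besselAux 2 y) ^ 2 * 16) /
        (16 * y - 3) ^ 2) y := by
    refine (((hasDerivAt_besselAux 1 y).pow 2).add ((hB.pow 2).div hlin hq)).congr_deriv ?_
    norm_num
  refine ((hasDerivAt_pow 3 y).mul (hE.pow 2)).congr_deriv ?_
  have hQ : besselEnergy y = besselAux 1 y ^ 2 +
    (3 * besselAux 1 y - 4 * y * besselAux 2 y) ^ 2 / (16 * y - 3) := rfl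
  generalize besselAux 1 y = a at *
  generalize besselAux 2 y = b at *
  obtain ⟨q, hqy⟩ : ∃ q, q = 16 * y - 3 := ⟨_, rfl⟩
  obtain rfl : y = (q + 3) / 16 := by linarith
  rw [← hqy] at hq hQ ⊢
  have key : 3 * besselEnergy ((q + 3) / 16) + 2 * ((q + 3) / 16) * (2 * a * -b +
      (2 * (3 * a - 4 * ((q + 3) / 16) * b) * (b - 4 * a) * q -
        (3 * a - 4 * ((q + 3) / 16) * b) ^ 2 * 16) / q ^ 2) =
      -6 * (3 * a - 4 * ((q + 3) / 16) * b) ^ 2 / q ^ 2 := by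
    rw [hQ]
    field_simp
    ring
  norm_num
  linear_combination ((q + 3) / 16) ^ 2 * besselEnergy ((q + 3) / 16) * key

theorem besselEnergy_four_le : besselEnergy 4 ≤ 1 / (2 * π * √15) := by
  have h1 := besselAux_le_partial_sum (m := 1) (y := 4) (by norm_num) le_rfl 3
  have h2 := partial_sum_le_besselAux (m := 1) (y := 4) (by norm_num) le_rfl 3
  have h3 := besselAux_le_partial_sum (m := 2) (y := 4) (by norm_num) le_rfl 3
  have h4 := partial_sum_le_besselAux (m := 2) (y := 4) (by norm_num) le_rfl 3
  norm_num [Finset.sum_range_succ, Nat.factorial] at h1 h2 h3 h4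
  have hE : besselEnergy 4 ≤ 41 / 1000 := by
    unfold besselEnergy
    nlinarith
  have hs : √15 ≤ 3.873 := Real.sqrt_le_iff.mpr (by norm_num)
  have hπ : π ≤ 3.1416 := Real.pi_lt_d4.le
  have h : 2 * π * √15 ≤ 2 * 3.1416 * 3.873 := by gcongr
  refine hE.trans ?_
  rw [le_div_iff₀ (by positivity)]
  linarith

theorem besselAux_one_sq_le {y : ℝ} (hy : 4 ≤ y) :
    y ^ 3 * (besselAux 1 y ^ 2) ^ 2 ≤ 4 ^ 3 * (1 / (2 * π * √15)) ^ 2 := by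
  have hanti : AntitoneOn (fun y => y ^ 3 * besselEnergy y ^ 2) (Ici 4) := by
    have hd : ∀ z ∈ Ici (4 : ℝ), 1 ≤ z := fun z hz => by linarith [mem_Ici.mp hz]
    refine antitoneOn_of_deriv_nonpos (convex_Ici 4)
      (fun z hz => (hasDerivAt_cube_mul_besselEnergy_sq
        (hd z hz)).continuousAt.continuousWithinAt)
      (fun z hz => (hasDerivAt_cube_mul_besselEnergy_sq
        (hd z (interior_subset hz))).differentiableAt.differentiableWithinAt) fun z hz => ?_
    have hz1 := hd z (interior_subset hz)
    rw [(hasDerivAt_cube_mul_besselEnergy_sq hz1).deriv]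
    have := besselEnergy_nonneg hz1
    have h0 : 0 ≤ z := by linarith
    exact neg_nonpos.mpr (by positivity)
  have hle : besselAux 1 y ^ 2 ≤ besselEnergy y := by
    have : 0 < 16 * y - 3 := by linarith
    unfold besselEnergy
    exact le_add_of_nonneg_right (by positivity)
  calc y ^ 3 * (besselAux 1 y ^ 2) ^ 2 ≤ y ^ 3 * besselEnergy y ^ 2 := by
        have : 0 ≤ y := by linarith
        gcongr
    _ ≤ 4 ^ 3 * besselEnergy 4 ^ 2 := hanti self_mem_Ici hy hy
    _ ≤ 4 ^ 3 * (1 / (2 * π * √15)) ^ 2 := by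
        have := besselEnergy_nonneg (y := 4) (by norm_num)
        have := besselEnergy_four_le
        gcongr

theorem jj1_sq_le {t : ℝ} (ht : 4 ≤ t) : jj1 t ^ 2 ≤ 4 ^ 3 / t ^ 3 / (2 * π * √15) := by
  have ht0 : 0 < t := by linarith
  have h := besselAux_one_sq_le (y := t ^ 2 / 4) (by nlinarith)
  rw [jj1_eq_besselAux]
  refine le_of_sq_le_sq ?_ (by positivity)
  rw [show 4 ^ 3 / t ^ 3 / (2 * π * √15) = 4 ^ 3 / t ^ 3 * (1 / (2 * π * √15)) by ring, mul_pow,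
    div_pow, div_mul_eq_mul_div, le_div_iff₀ (by positivity)]
  nlinarith

theorem exp_neg_le_quadratic {x : ℝ} (hx : 0 ≤ x) : exp (-x) ≤ 1 - x + x ^ 2 / 2 := by
  have hpos : 0 < 1 - x + x ^ 2 / 2 := by nlinarith [sq_nonneg (x - 1)]
  have h := quadratic_le_exp_of_nonneg hx
  rw [exp_neg, inv_le_iff_one_le_mul₀ (exp_pos x)]
  nlinarith [mul_le_mul_of_nonneg_left h hpos.le, pow_nonneg hx 4]

/-- The integrand on `(0, 4]` that dominates `|𝔧₁(t)|^s t^{p-1}`. -/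
noncomputable def gaussMajorant (p s t : ℝ) : ℝ :=
  t ^ (p - 1) * (exp (-(s * (t ^ 2 / 8))) * (1 - s * t ^ 4 / 384 + s ^ 2 * t ^ 8 / 294912))

theorem gaussMajorant_pos {p s t : ℝ} (ht : 0 < t) : 0 < gaussMajorant p s t := by
  have h : 0 < 1 - s * t ^ 4 / 384 + s ^ 2 * t ^ 8 / 294912 := by
    nlinarith [sq_nonneg (s * t ^ 4 / 384 - 1)]
  unfold gaussMajorant
  positivity

theorem le_gaussMajorant {p s t : ℝ} (hs : 0 < s) (ht0 : 0 < t) (ht : t ≤ 4) :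
    |jj1 t| ^ s * t ^ (p - 1) ≤ gaussMajorant p s t := by
  rw [mul_comm, gaussMajorant]
  gcongr
  calc |jj1 t| ^ s ≤ exp (-(t ^ 2 / 8 + t ^ 4 / 384)) ^ s := by
        gcongr
        exact abs_jj1_le_exp ht0.le ht
    _ = exp (-(s * (t ^ 2 / 8))) * exp (-(s * t ^ 4 / 384)) := by
        rw [← Real.exp_mul, ← exp_add]
        ring_nf
    _ ≤ _ := by
        gcongr
        refine (exp_neg_le_quadratic (by positivity)).trans_eq ?_
        ring

theorem gaussMajorant_eq {p s t : ℝ} (ht : 0 < t) :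
    gaussMajorant p s t = t ^ (p - 1) * exp (-(s / 8) * t ^ (2 : ℝ)) -
      s / 384 * (t ^ (p + 3) * exp (-(s / 8) * t ^ (2 : ℝ))) +
      s ^ 2 / 294912 * (t ^ (p + 7) * exp (-(s / 8) * t ^ (2 : ℝ))) := by
  have h3 : t ^ (p + 3) = t ^ (p - 1) * t ^ 4 := by
    rw [← rpow_natCast t 4, ← rpow_add ht]
    norm_num
    ring_nf
  have h7 : t ^ (p + 7) = t ^ (p - 1) * t ^ 8 := by
    rw [← rpow_natCast t 8, ← rpow_add ht]
    norm_num
    ring_nf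
  rw [gaussMajorant, h3, h7, rpow_two, show -(s * (t ^ 2 / 8)) = -(s / 8) * t ^ 2 by ring]
  ring

theorem integrableOn_gaussMajorant {p s : ℝ} (hp : 0 < p) (hs : 0 < s) :
    IntegrableOn (gaussMajorant p s) (Ioi 0) := by
  have hi : ∀ q : ℝ, -1 < q →
      IntegrableOn (fun t : ℝ => t ^ q * exp (-(s / 8) * t ^ (2 : ℝ))) (Ioi 0) := fun q hq =>
    integrableOn_rpow_mul_exp_neg_mul_rpow hq two_pos (by positivity)
  refine IntegrableOn.congr_fun (((hi (p - 1) (by linarith)).sub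
    ((hi (p + 3) (by linarith)).const_mul (s / 384))).add
    ((hi (p + 7) (by linarith)).const_mul (s ^ 2 / 294912)))
    (fun t ht => (gaussMajorant_eq ht).symm) measurableSet_Ioi

theorem integral_gaussMajorant {p s : ℝ} (hp : 0 < p) (hs : 0 < s) :
    ∫ t in Ioi 0, gaussMajorant p s t = 2 ^ (3 * p / 2 - 1) * s ^ (-p / 2) *
      (Real.Gamma (p / 2) - Real.Gamma (p / 2 + 2) / (6 * s) +
        Real.Gamma (p / 2 + 4) / (72 * s ^ 2)) := by
  have hs8 : 0 < s / 8 := by positivity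
  have hi : ∀ q : ℝ, -1 < q →
      IntegrableOn (fun t : ℝ => t ^ q * exp (-(s / 8) * t ^ (2 : ℝ))) (Ioi 0) := fun q hq =>
    integrableOn_rpow_mul_exp_neg_mul_rpow hq two_pos hs8
  have h1 := hi (p - 1) (by linarith)
  have h2 := (hi (p + 3) (by linarith)).const_mul (s / 384)
  have h3 := (hi (p + 7) (by linarith)).const_mul (s ^ 2 / 294912)
  have h12 : IntegrableOn (fun t : ℝ => t ^ (p - 1) * exp (-(s / 8) * t ^ (2 : ℝ)) -
      s / 384 * (t ^ (p + 3) * exp (-(s / 8) * t ^ (2 : ℝ)))) (Ioi 0) := h1.sub h2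
  rw [setIntegral_congr_fun measurableSet_Ioi fun t ht => gaussMajorant_eq ht,
    integral_add h12 h3, integral_sub h1 h2, integral_const_mul, integral_const_mul,
    integral_rpow_mul_exp_neg_mul_rpow two_pos (by linarith) hs8,
    integral_rpow_mul_exp_neg_mul_rpow two_pos (by linarith) hs8,
    integral_rpow_mul_exp_neg_mul_rpow two_pos (by linarith) hs8,
    show (p - 1 + 1) / 2 = p / 2 by ring, show (p + 3 + 1) / 2 = p / 2 + 2 by ring,
    show (p + 7 + 1) / 2 = p / 2 + 4 by ring, show -(p - 1 + 1) / 2 = -p / 2 by ring,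
    show -(p + 3 + 1) / 2 = -p / 2 - (2 : ℕ) by push_cast; ring,
    show -(p + 7 + 1) / 2 = -p / 2 - (4 : ℕ) by push_cast; ring,
    rpow_sub_natCast hs8.ne', rpow_sub_natCast hs8.ne']
  have hc : (2 : ℝ) ^ (3 * p / 2 - 1) * s ^ (-p / 2) = (s / 8) ^ (-p / 2) / 2 := by
    rw [div_rpow hs.le (by norm_num), rpow_sub_one (by norm_num),
      show (8 : ℝ) = 2 ^ (3 : ℝ) by norm_num, ← rpow_mul (by norm_num),
      show 3 * (-p / 2) = -(3 * p / 2) by ring, rpow_neg (by norm_num)]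
    field_simp
  rw [hc]
  field_simp
  ring

/-- The integrand on `(4, ∞)` that dominates `|𝔧₁(t)|^s t^{p-1}`. -/
noncomputable def powerMajorant (p s t : ℝ) : ℝ :=
  4 ^ (3 * s / 2) * (2 * π * √15) ^ (-s / 2) * t ^ (p - 1 - 3 * s / 2)

theorem le_powerMajorant {p s t : ℝ} (hs : 0 < s) (ht : 4 ≤ t) :
    |jj1 t| ^ s * t ^ (p - 1) ≤ powerMajorant p s t := by
  have ht0 : 0 < t := by linarith
  have hc : 0 < 2 * π * √15 := by positivity
  have h : |jj1 t| ^ s ≤ 4 ^ (3 * s / 2) * (2 * π * √15) ^ (-s / 2) * t ^ (-(3 * s / 2)) := by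
    calc |jj1 t| ^ s = (jj1 t ^ 2) ^ (s / 2) := by
          rw [← sq_abs, ← rpow_natCast, ← rpow_mul (abs_nonneg _)]
          congr 1
          push_cast
          ring
      _ ≤ (4 ^ 3 / t ^ 3 / (2 * π * √15)) ^ (s / 2) := by
          gcongr
          exact jj1_sq_le ht
      _ = _ := by
          rw [div_rpow (by positivity) hc.le, div_rpow (by positivity) (by positivity),
            ← rpow_natCast, ← rpow_natCast, ← rpow_mul (by norm_num), ← rpow_mul ht0.le,
            neg_div, rpow_neg hc.le, rpow_neg ht0.le]
          push_cast
          rw [show 3 * (s / 2) = 3 * s / 2 by ring]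
          ring
  rw [powerMajorant, show p - 1 - 3 * s / 2 = -(3 * s / 2) + (p - 1) by ring, rpow_add ht0,
    ← mul_assoc]
  gcongr

theorem integrableOn_powerMajorant {p s : ℝ} (hps : p < 3 * s / 2) :
    IntegrableOn (powerMajorant p s) (Ioi 4) :=
  (integrableOn_Ioi_rpow_of_lt (by linarith) (by norm_num)).const_mul _

theorem integral_powerMajorant {p s : ℝ} (hps : p < 3 * s / 2) :
    ∫ t in Ioi 4, powerMajorant p s t =
      4 ^ p * (2 * π * √15) ^ (-s / 2) / (3 * s / 2 - p) := by
  unfold powerMajorant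
  rw [integral_const_mul, integral_Ioi_rpow_of_lt (by linarith) (by norm_num),
    show p - 1 - 3 * s / 2 + 1 = p - 3 * s / 2 by ring, rpow_sub (by norm_num)]
  have h1 : 3 * s / 2 - p ≠ 0 := by linarith
  have h2 : p - 3 * s / 2 ≠ 0 := by linarith
  rw [show p - 3 * s / 2 = -(3 * s / 2 - p) by ring, neg_div_neg_eq]
  have h4 : (4 : ℝ) ^ (3 * s / 2) ≠ 0 := by positivity
  field_simp

/-- For all `p, s > 0` with `p < 3s/2`: `F(p,s) < U(p,s)`. -/
theorem F_lt_U (p s : ℝ) (hp : 0 < p) (hs : 0 < s) (hps : p < 3 * s / 2) :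
    ∫⁻ t in Set.Ioi (0 : ℝ), ENNReal.ofReal (|jj1 t| ^ s * t ^ (p - 1))
      < ENNReal.ofReal (Ufun p s) := by
  have hG := integrableOn_gaussMajorant hp hs
  have hG₁ : IntegrableOn (gaussMajorant p s) (Ioc 0 4) := hG.mono_set Ioc_subset_Ioi_self
  have hG₂ : IntegrableOn (gaussMajorant p s) (Ioi 4) :=
    hG.mono_set (Ioi_subset_Ioi (by norm_num))
  have hunion : Ioc (0 : ℝ) 4 ∪ Ioi 4 = Ioi 0 := Ioc_union_Ioi_eq_Ioi (by norm_num)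
  have hdisj : Disjoint (Ioc (0 : ℝ) 4) (Ioi 4) := Ioc_disjoint_Ioi le_rfl
  have htail : 0 < ∫ t in Ioi 4, gaussMajorant p s t := by
    have hpos : ∀ t ∈ Ioi (4 : ℝ), 0 < gaussMajorant p s t := fun t ht =>
      gaussMajorant_pos (by linarith [mem_Ioi.mp ht])
    rw [setIntegral_pos_iff_support_of_nonneg_ae
      (ae_restrict_of_forall_mem measurableSet_Ioi fun t ht => (hpos t ht).le) hG₂,
      inter_eq_right.mpr fun t ht => Function.mem_support.mpr (hpos t ht).ne']
    simp
  have hsplit : ∫ t in Ioi 0, gaussMajorant p s t =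
      (∫ t in Ioc 0 4, gaussMajorant p s t) + ∫ t in Ioi 4, gaussMajorant p s t := by
    rw [← hunion, setIntegral_union hdisj measurableSet_Ioi hG₁ hG₂]
  have hnn₁ : 0 ≤ᵐ[volume.restrict (Ioc 0 4)] gaussMajorant p s :=
    ae_restrict_of_forall_mem measurableSet_Ioc fun t ht => (gaussMajorant_pos ht.1).le
  have hnn₂ : 0 ≤ᵐ[volume.restrict (Ioi 4)] powerMajorant p s :=
    ae_restrict_of_forall_mem measurableSet_Ioi fun t ht => by
      have : (0 : ℝ) < t := by linarith [mem_Ioi.mp ht]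
      exact mul_nonneg (by positivity) (by positivity)
  calc ∫⁻ t in Ioi (0 : ℝ), ENNReal.ofReal (|jj1 t| ^ s * t ^ (p - 1))
      = (∫⁻ t in Ioc (0 : ℝ) 4, ENNReal.ofReal (|jj1 t| ^ s * t ^ (p - 1))) +
          ∫⁻ t in Ioi (4 : ℝ), ENNReal.ofReal (|jj1 t| ^ s * t ^ (p - 1)) := by
        rw [← hunion, lintegral_union measurableSet_Ioi hdisj]
    _ ≤ (∫⁻ t in Ioc (0 : ℝ) 4, ENNReal.ofReal (gaussMajorant p s t)) +
          ∫⁻ t in Ioi (4 : ℝ), ENNReal.ofReal (powerMajorant p s t) := by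
        refine add_le_add (setLIntegral_mono' measurableSet_Ioc fun t ht => ?_)
          (setLIntegral_mono' measurableSet_Ioi fun t ht => ?_)
        · exact ENNReal.ofReal_le_ofReal (le_gaussMajorant hs ht.1 ht.2)
        · exact ENNReal.ofReal_le_ofReal (le_powerMajorant hs (mem_Ioi.mp ht).le)
    _ = ENNReal.ofReal ((∫ t in Ioc 0 4, gaussMajorant p s t) +
          ∫ t in Ioi 4, powerMajorant p s t) := by
        rw [← ofReal_integral_eq_lintegral_ofReal hG₁ hnn₁,
          ← ofReal_integral_eq_lintegral_ofReal (integrableOn_powerMajorant hps) hnn₂,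
          ENNReal.ofReal_add (integral_nonneg_of_ae hnn₁) (integral_nonneg_of_ae hnn₂)]
    _ < ENNReal.ofReal (Ufun p s) := by
        have hlt : (∫ t in Ioc 0 4, gaussMajorant p s t) + ∫ t in Ioi 4, powerMajorant p s t <
            Ufun p s := by
          rw [Ufun, ← integral_gaussMajorant hp hs, ← integral_powerMajorant hps, hsplit]
          linarith
        exact (ENNReal.ofReal_lt_ofReal_iff_of_nonneg (add_nonneg (integral_nonneg_of_ae hnn₁)
          (integral_nonneg_of_ae hnn₂))).mpr hlt
end

section
/- Define U(p,s) = 4^p (2π·15^{1/2})^{-s/2} / (3s/2 - p) + 2^{3p/2-1} s^{-p/2} ( Γ(p/2) - Γ(p/2+2)/(6s) + Γ(p/2+4)/(72 s²) ) and G(p,s) = s^{-p/2} 2^{3p/2-1} Γ(p/2). Then U(p,s) < G(p,s) in the following cases: (i) 0 < p ≤ 1/4 and s ≥ 17/10; (ii) 0 < p ≤ 4/5 and s ≥ 2; (iii) 0 < p ≤ 2 and s ≥ 8/3. -/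
open Real

/-- `G(p,s) = ∫_0^∞ e^{-st²/8} t^{p-1} dt = s^{-p/2} 2^{3p/2-1} Γ(p/2)`. -/
noncomputable def Gfun (p s : ℝ) : ℝ :=
  s ^ (-p / 2) * 2 ^ (3 * p / 2 - 1) * Real.Gamma (p / 2)

/-- Multiplying `(2 s) ^ x` by `c ^ (-s / 2)` gives a function decreasing in `s ≥ 1`,
for `c ≥ 9` and `x ≤ 1`. -/
lemma rpow_mul_rpow_neg_half_le {c x s₀ s : ℝ} (hc : 9 ≤ c) (hx1 : x ≤ 1)
    (hs₀ : 1 ≤ s₀) (hs : s₀ ≤ s) :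
    (2 * s) ^ x * c ^ (-s / 2) ≤ (2 * s₀) ^ x * c ^ (-s₀ / 2) := by
  have h0 : 0 < s₀ := by linarith
  have hc0 : 0 < c := by linarith
  have hr : 1 ≤ s / s₀ := (one_le_div h0).2 hs
  have h1 : (s / s₀) ^ x ≤ s / s₀ := by
    simpa using rpow_le_rpow_of_exponent_le hr hx1
  have h2 : s / s₀ ≤ 1 + (s - s₀) := by
    rw [div_le_iff₀ h0]
    nlinarith
  have h3 : 1 + (s - s₀) ≤ exp (s - s₀) := by
    linarith [add_one_le_exp (s - s₀)]
  have h4 : exp (s - s₀) ≤ c ^ ((s - s₀) / 2) := by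
    have he : exp 2 ≤ c := by
      have h := exp_one_lt_three
      have h' : exp 2 = exp 1 * exp 1 := by rw [← exp_add]; norm_num
      nlinarith [exp_pos 1]
    have h := rpow_le_rpow (exp_pos 2).le he (by linarith : 0 ≤ (s - s₀) / 2)
    rw [← exp_mul] at h
    convert h using 2
    ring
  have h5 : (2 * s) ^ x = (2 * s₀) ^ x * (s / s₀) ^ x := by
    rw [← mul_rpow (by positivity) (by positivity)]
    congr 1
    field_simp
  have h6 : c ^ (-s₀ / 2) = c ^ (-s / 2) * c ^ ((s - s₀) / 2) := by
    rw [← rpow_add hc0]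
    congr 1
    ring
  rw [h5, h6]
  calc (2 * s₀) ^ x * (s / s₀) ^ x * c ^ (-s / 2)
      ≤ (2 * s₀) ^ x * c ^ ((s - s₀) / 2) * c ^ (-s / 2) := by
        gcongr
        linarith
    _ = _ := by ring

lemma le_two_pi_sqrt_fifteen : 243 / 10 ≤ 2 * π * √15 := by
  have h1 : (387 / 100 : ℝ) ≤ √15 := le_sqrt_of_sq_le (by norm_num)
  nlinarith [pi_gt_d2]

/-- A lower bound `243 / 10 ≤ 2π√15` turned into an upper bound for a negative rational power. -/
lemma two_pi_sqrt_fifteen_rpow_le {y K : ℝ} (m n : ℕ) (hn : n ≠ 0) (hK : 0 < K)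
    (hy : y = -(m / n : ℝ)) (h : K⁻¹ ^ n ≤ (243 / 10 : ℝ) ^ m) :
    (2 * π * √15) ^ y ≤ K := by
  have hc := le_two_pi_sqrt_fifteen
  have hc0 : 0 ≤ 2 * π * √15 := by positivity
  have h1 : K⁻¹ ≤ (2 * π * √15) ^ (m / n : ℝ) := by
    refine le_of_pow_le_pow_left₀ hn (by positivity) ?_
    rw [← rpow_natCast _ n, ← rpow_natCast _ n, ← rpow_mul hc0,
      div_mul_cancel₀ _ (Nat.cast_ne_zero.2 hn), rpow_natCast, rpow_natCast]
    exact h.trans (by gcongr)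
  rw [hy, rpow_neg hc0]
  exact inv_le_of_inv_le₀ hK h1

/-- The inequality `U < G` follows for all `s ≥ s₀` from an inequality at `s₀`. -/
lemma Ufun_lt_Gfun_of_le {x s₀ s K : ℝ} (hx0 : 0 < x) (hx1 : x ≤ 1) (hs₀ : 1 < s₀)
    (hs : s₀ ≤ s) (hK : (2 * π * √15) ^ (-s₀ / 2) ≤ K)
    (h : 144 * s₀ ^ 2 * ((2 * s₀) ^ x * K) <
      Real.Gamma (x + 2) * ((3 * s₀ / 2 - 2 * x) * (12 * s₀ - (x + 2) * (x + 3))))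
    (hA : 0 < 3 * s₀ / 2 - 2 * x) (hB : 0 < 12 * s₀ - (x + 2) * (x + 3)) :
    Ufun (2 * x) s < Gfun (2 * x) s := by
  have h0 : 0 < s₀ := by linarith
  have hs0 : 0 < s := by linarith
  have hΓ : 0 < Real.Gamma (x + 2) := Gamma_pos_of_pos (by linarith)
  have hE := rpow_mul_rpow_neg_half_le (c := 2 * π * √15)
    (by linarith [le_two_pi_sqrt_fifteen]) hx1 hs₀.le hs
  have hE' : (2 * s) ^ x * (2 * π * √15) ^ (-s / 2) ≤ (2 * s₀) ^ x * K :=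
    hE.trans (by gcongr)
  have hA' : s * (3 * s₀ / 2 - 2 * x) ≤ s₀ * (3 * s / 2 - 2 * x) := by nlinarith
  have hB' : s * (12 * s₀ - (x + 2) * (x + 3)) ≤ s₀ * (12 * s - (x + 2) * (x + 3)) := by
    nlinarith [mul_pos (by linarith : 0 < x + 2) (by linarith : 0 < x + 3)]
  have hAs : 0 < 3 * s / 2 - 2 * x := by linarith
  have hmain : 144 * s ^ 2 * ((2 * s) ^ x * (2 * π * √15) ^ (-s / 2)) <
      Real.Gamma (x + 2) * ((3 * s / 2 - 2 * x) * (12 * s - (x + 2) * (x + 3))) := by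
    refine lt_of_mul_lt_mul_left ?_ (sq_nonneg s₀)
    calc s₀ ^ 2 * (144 * s ^ 2 * ((2 * s) ^ x * (2 * π * √15) ^ (-s / 2)))
        ≤ s₀ ^ 2 * (144 * s ^ 2 * ((2 * s₀) ^ x * K)) := by gcongr
      _ = s ^ 2 * (144 * s₀ ^ 2 * ((2 * s₀) ^ x * K)) := by ring
      _ < s ^ 2 * (Real.Gamma (x + 2) *
            ((3 * s₀ / 2 - 2 * x) * (12 * s₀ - (x + 2) * (x + 3)))) := by gcongr
      _ = Real.Gamma (x + 2) * ((s * (3 * s₀ / 2 - 2 * x)) *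
            (s * (12 * s₀ - (x + 2) * (x + 3)))) := by ring
      _ ≤ Real.Gamma (x + 2) * ((s₀ * (3 * s / 2 - 2 * x)) *
            (s₀ * (12 * s - (x + 2) * (x + 3)))) := by gcongr
      _ = _ := by ring
  have hΓ4 : Real.Gamma (x + 4) = (x + 3) * ((x + 2) * Real.Gamma (x + 2)) := by
    rw [← Gamma_add_one (by linarith : x + 2 ≠ 0), show x + 2 + 1 = x + 3 by ring,
      ← Gamma_add_one (by linarith : x + 3 ≠ 0), show x + 3 + 1 = x + 4 by ring]
  have h4 : (4 : ℝ) ^ (2 * x) = 2 * 2 ^ x * 2 ^ (3 * x - 1) := by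
    rw [show (4 : ℝ) = 2 ^ (2 : ℝ) by norm_num, ← rpow_mul (by norm_num),
      mul_assoc, ← rpow_add (by norm_num), ← rpow_one_add' (by norm_num) (by linarith)]
    congr 1
    ring
  have hms : (2 * s) ^ x = 2 ^ x * s ^ x := mul_rpow (by norm_num) hs0.le
  have hneg : s ^ (-(2 * x) / 2) = (s ^ x)⁻¹ := by
    rw [← rpow_neg hs0.le]
    congr 1
    ring
  unfold Ufun Gfun
  rw [hneg, h4, show 2 * x / 2 = x by ring, show 3 * (2 * x) / 2 - 1 = 3 * x - 1 by ring, hΓ4]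
  rw [hms] at hmain
  have hb : 0 < s ^ x := by positivity
  have hP : (0 : ℝ) < 2 ^ (3 * x - 1) := by positivity
  generalize (2 * π * √15) ^ (-s / 2) = C at *
  generalize s ^ x = b at *
  generalize (2 : ℝ) ^ (3 * x - 1) = P at *
  generalize (2 : ℝ) ^ x = a at *
  generalize Real.Gamma (x + 2) = g at *
  have key : 2 * a * P * C / (3 * s / 2 - 2 * x) <
      P * b⁻¹ * (g * (12 * s - (x + 2) * (x + 3)) / (72 * s ^ 2)) := by
    rw [div_lt_iff₀ hAs]
    have : P * b⁻¹ * (g * (12 * s - (x + 2) * (x + 3)) / (72 * s ^ 2)) * (3 * s / 2 - 2 * x)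
        = P * (g * ((3 * s / 2 - 2 * x) * (12 * s - (x + 2) * (x + 3)))) / (72 * s ^ 2 * b) := by
      field_simp
    rw [this, lt_div_iff₀ (by positivity)]
    calc 2 * a * P * C * (72 * s ^ 2 * b) = P * (144 * s ^ 2 * (a * b * C)) := by ring
      _ < _ := by gcongr
  have hsplit : P * b⁻¹ * (Real.Gamma x - g / (6 * s) + (x + 3) * ((x + 2) * g) / (72 * s ^ 2)) =
      b⁻¹ * P * Real.Gamma x - P * b⁻¹ * (g * (12 * s - (x + 2) * (x + 3)) / (72 * s ^ 2)) := by
    field_simp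
    ring
  rw [hsplit]
  linarith

/-- Convexity of `log Γ`, as an inequality between adjacent slopes without divisions. -/
lemma log_Gamma_slope_le {u v w : ℝ} (hu : 0 < u) (huv : u < v) (hvw : v < w) :
    (log (Real.Gamma v) - log (Real.Gamma u)) * (w - v) ≤
      (log (Real.Gamma w) - log (Real.Gamma v)) * (v - u) := by
  have h := convexOn_log_Gamma.slope_mono_adjacent (x := u) (y := v) (z := w) hu
    (by simp only [Set.mem_Ioi]; linarith) huv hvw
  simp only [Function.comp] at h
  rwa [div_le_div_iff₀ (by linarith) (by linarith)] at h

lemma Gamma_three_halves_sq : Real.Gamma (3 / 2) ^ 2 = π / 4 := by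
  rw [show (3 / 2 : ℝ) = 1 / 2 + 1 by norm_num, Gamma_add_one (by norm_num), Gamma_one_half_eq,
    mul_pow, sq_sqrt pi_pos.le]
  ring

lemma Gamma_five_halves_sq : Real.Gamma (5 / 2) ^ 2 = 9 * π / 16 := by
  rw [show (5 / 2 : ℝ) = 3 / 2 + 1 by norm_num, Gamma_add_one (by norm_num), mul_pow,
    Gamma_three_halves_sq]
  ring

lemma Gamma_three : Real.Gamma 3 = 2 := by
  simp [Nat.factorial]

lemma Gamma_four : Real.Gamma 4 = 6 := by
  simp [Nat.factorial]

lemma one_le_Gamma_add_two_mul {x : ℝ} (hx : 0 < x) :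
    1 ≤ Real.Gamma (x + 2) * (π / 4) ^ x := by
  have h := log_Gamma_slope_le (u := 3 / 2) (v := 2) (w := x + 2) (by norm_num) (by norm_num)
    (by linarith)
  have hΓ : 0 < Real.Gamma (x + 2) := Gamma_pos_of_pos (by linarith)
  have hl : log (π / 4) = 2 * log (Real.Gamma (3 / 2)) := by
    rw [← Gamma_three_halves_sq, log_pow]
    norm_num
  rw [Gamma_two, log_one] at h
  rw [← log_nonneg_iff (by positivity), log_mul hΓ.ne' (by positivity),
    log_rpow (by positivity), hl]
  linarith

lemma mul_four_rpow_le_Gamma_add_two_mul {x : ℝ} (hx0 : 0 < x) (hx : x < 1 / 2) :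
    9 * π / 32 * 4 ^ x ≤ Real.Gamma (x + 2) * (9 * π / 16) ^ x := by
  have h := log_Gamma_slope_le (u := x + 2) (v := 5 / 2) (w := 3) (by linarith) (by linarith)
    (by norm_num)
  have hΓ : 0 < Real.Gamma (x + 2) := Gamma_pos_of_pos (by linarith)
  have hl : log (9 * π / 16) = 2 * log (Real.Gamma (5 / 2)) := by
    rw [← Gamma_five_halves_sq, log_pow]
    norm_num
  have hl' : log (9 * π / 32) = 2 * log (Real.Gamma (5 / 2)) - log 2 := by
    rw [← hl, ← log_div (by positivity) (by norm_num)]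
    congr 1
    ring
  have hl4 : log 4 = 2 * log 2 := by
    rw [show (4 : ℝ) = 2 ^ 2 by norm_num, log_pow]
    norm_num
  rw [Gamma_three] at h
  rw [← log_le_log_iff (by positivity) (by positivity), log_mul (by positivity) (by positivity),
    log_mul hΓ.ne' (by positivity), log_rpow (by positivity), log_rpow (by positivity), hl, hl',
    hl4]
  nlinarith

lemma two_mul_three_rpow_le_Gamma_add_two_mul {x : ℝ} (hx0 : 0 < x) (hx : x ≤ 1) :
    2 * 3 ^ x ≤ Real.Gamma (x + 2) * 3 := by
  rcases hx.eq_or_lt with rfl | hx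
  · norm_num [Gamma_three]
  have h := log_Gamma_slope_le (u := x + 2) (v := 3) (w := 4) (by linarith) (by linarith)
    (by norm_num)
  have hΓ : 0 < Real.Gamma (x + 2) := Gamma_pos_of_pos (by linarith)
  have hl : log 6 = log 2 + log 3 := by
    rw [← log_mul (by norm_num) (by norm_num)]
    norm_num
  rw [Gamma_three, Gamma_four, hl] at h
  rw [← log_le_log_iff (by positivity) (by positivity), log_mul (by positivity) (by positivity),
    log_mul hΓ.ne' (by positivity), log_rpow (by positivity)]
  nlinarith

/-- A chord bound for `a ^ x`, where `r` is an upper bound for `a ^ (m / n)`. -/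
lemma rpow_le_one_add_of_pow_le {a x r : ℝ} (m n : ℕ) (hm : m ≠ 0) (hn : n ≠ 0) (ha : 0 ≤ a)
    (hr : 0 ≤ r) (h : a ^ m ≤ r ^ n) (hx0 : 0 ≤ x) (hx : x ≤ m / n) :
    a ^ x ≤ 1 + n / m * x * (r - 1) := by
  have hm0 : (0 : ℝ) < m := by positivity
  have hn0 : (0 : ℝ) < n := by positivity
  have h1 : a ^ x ≤ r ^ (n / m * x) := by
    have h2 := rpow_le_rpow (by positivity) h (by positivity : 0 ≤ x / m)
    rw [← rpow_natCast, ← rpow_natCast, ← rpow_mul ha, ← rpow_mul hr] at h2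
    convert h2 using 2 <;> field_simp
  have h3 : n / m * x ≤ 1 := by
    calc (n / m * x : ℝ) ≤ n / m * (m / n) := by gcongr
      _ = 1 := by field_simp
  have h4 := rpow_one_add_le_one_add_mul_self (s := r - 1) (by linarith)
    (by positivity : 0 ≤ n / m * x) h3
  rw [add_sub_cancel] at h4
  exact h1.trans h4

/-- `U(p,s) < G(p,s)` holds when (i) `0 < p ≤ 1/4` and `s ≥ 17/10`;
(ii) `0 < p ≤ 4/5` and `s ≥ 2`; (iii) `0 < p ≤ 2` and `s ≥ 8/3`. -/
theorem U_lt_G (p s : ℝ)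
    (h : (0 < p ∧ p ≤ 1 / 4 ∧ 17 / 10 ≤ s) ∨
         (0 < p ∧ p ≤ 4 / 5 ∧ 2 ≤ s) ∨
         (0 < p ∧ p ≤ 2 ∧ 8 / 3 ≤ s)) :
    Ufun p s < Gfun p s := by
  obtain ⟨x, rfl⟩ : ∃ x, p = 2 * x := ⟨p / 2, by ring⟩
  have hπ := pi_gt_d4
  have hπ' := pi_lt_d4
  rcases h with ⟨h0, h1, hs⟩ | ⟨h0, h1, hs⟩ | ⟨h0, h1, hs⟩
  · have hx0 : 0 < x := by linarith
    have hx1 : x ≤ 1 / 8 := by linarith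
    refine Ufun_lt_Gfun_of_le (K := 1 / 15) hx0 (by linarith) (by norm_num) hs
      (two_pi_sqrt_fifteen_rpow_le 17 20 (by norm_num) (by norm_num) (by norm_num) (by norm_num))
      ?_ (by linarith) (by nlinarith)
    have hΓ := one_le_Gamma_add_two_mul hx0
    have hq : (0 : ℝ) < (π / 4) ^ x := by positivity
    have hr := rpow_le_one_add_of_pow_le (a := 2 * (17 / 10) * (π / 4)) (x := x)
      (r := 1131 / 1000) 1 8 (by norm_num) (by norm_num) (by positivity) (by norm_num)
      (by norm_num; linarith) hx0.le (by norm_num; linarith)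
    rw [mul_rpow (by norm_num) (by positivity)] at hr
    refine lt_of_mul_lt_mul_right (a := (π / 4) ^ x) ?_ hq.le
    have hD : 0 < (3 * (17 / 10) / 2 - 2 * x) * (12 * (17 / 10) - (x + 2) * (x + 3)) :=
      mul_pos (by linarith) (by nlinarith)
    have hpoly : 144 * (17 / 10) ^ 2 * (1 / 15) * (1 + 8 * x * (131 / 1000)) <
        (3 * (17 / 10) / 2 - 2 * x) * (12 * (17 / 10) - (x + 2) * (x + 3)) := by
      nlinarith [mul_nonneg hx0.le (sub_nonneg.2 hx1), pow_pos hx0 3]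
    norm_num at hr hpoly hD hΓ ⊢
    nlinarith [mul_le_mul_of_nonneg_right hΓ hD.le]
  · have hx0 : 0 < x := by linarith
    have hx1 : x ≤ 2 / 5 := by linarith
    refine Ufun_lt_Gfun_of_le (K := 10 / 243) hx0 (by linarith) (by norm_num) hs
      (two_pi_sqrt_fifteen_rpow_le 1 1 (by norm_num) (by norm_num) (by norm_num) (by norm_num))
      ?_ (by linarith) (by nlinarith)
    have hΓ := mul_four_rpow_le_Gamma_add_two_mul hx0 (by linarith)
    have hq : (0 : ℝ) < (9 * π / 16) ^ x := by positivity
    have hr := rpow_le_one_add_of_pow_le (a := 9 * π / 16) (x := x)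
      (r := 1256 / 1000) 2 5 (by norm_num) (by norm_num) (by positivity) (by norm_num)
      (by norm_num; nlinarith) hx0.le (by norm_num; linarith)
    have h4 : (0 : ℝ) < 4 ^ x := by positivity
    refine lt_of_mul_lt_mul_right (a := (9 * π / 16) ^ x) ?_ hq.le
    have hD : 0 < (3 * 2 / 2 - 2 * x) * (12 * 2 - (x + 2) * (x + 3)) :=
      mul_pos (by linarith) (by nlinarith)
    have hpoly : 144 * 2 ^ 2 * (10 / 243) * (1 + 5 / 2 * x * (256 / 1000)) <
        88 / 100 * ((3 * 2 / 2 - 2 * x) * (12 * 2 - (x + 2) * (x + 3))) := by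
      nlinarith [mul_nonneg hx0.le (sub_nonneg.2 hx1), pow_pos hx0 3]
    have hg : 88 / 100 * 4 ^ x ≤ Real.Gamma (x + 2) * (9 * π / 16) ^ x :=
      le_trans (mul_le_mul_of_nonneg_right (by linarith) h4.le) hΓ
    norm_num at hr hpoly hD hg ⊢
    nlinarith [mul_le_mul_of_nonneg_right hg hD.le, mul_lt_mul_of_pos_left hpoly h4,
      mul_le_mul_of_nonneg_left hr h4.le]
  · have hx0 : 0 < x := by linarith
    have hx1 : x ≤ 1 := by linarith
    refine Ufun_lt_Gfun_of_le (K := 1 / 70) hx0 (by linarith) (by norm_num) hs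
      (two_pi_sqrt_fifteen_rpow_le 4 3 (by norm_num) (by norm_num) (by norm_num) (by norm_num))
      ?_ (by linarith) (by nlinarith)
    have hΓ := two_mul_three_rpow_le_Gamma_add_two_mul hx0 hx1
    have hr := rpow_le_one_add_of_pow_le (a := 16 / 9) (x := x)
      (r := 16 / 9) 1 1 (by norm_num) (by norm_num) (by positivity) (by norm_num)
      (by norm_num) hx0.le (by norm_num; linarith)
    have h3 : (0 : ℝ) < 3 ^ x := by positivity
    have hsplit : (2 * (8 / 3) : ℝ) ^ x = 3 ^ x * (16 / 9) ^ x := by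
      rw [← mul_rpow (by norm_num) (by norm_num)]
      norm_num
    rw [hsplit]
    have hD : 0 ≤ (3 * (8 / 3) / 2 - 2 * x) * (12 * (8 / 3) - (x + 2) * (x + 3)) :=
      mul_nonneg (by linarith) (by nlinarith)
    have hpoly : 144 * (8 / 3) ^ 2 * (1 / 70) * (1 + x * (7 / 9)) <
        2 / 3 * ((3 * (8 / 3) / 2 - 2 * x) * (12 * (8 / 3) - (x + 2) * (x + 3))) := by
      nlinarith [mul_nonneg hx0.le (sub_nonneg.2 hx1), pow_pos hx0 3]
    norm_num at hr hpoly hD ⊢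
    nlinarith [mul_le_mul_of_nonneg_right hΓ hD, mul_lt_mul_of_pos_left hpoly h3,
      mul_le_mul_of_nonneg_left hr h3.le]
end
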